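/- Let k ≥ 2, n ≥ 4, and m ≥ 3. Then: if m ≡ 0 (mod 5), γ_{[k]R}(C_m □ P_n) ≤ (m/5)(n(k+1) + 2k); if m ≡ 1 (mod 5), γ_{[k]R}(C_m □ P_n) ≤ ((m+4)/5)(n(k+1) + 2k) − (4k+1) − 2(k+2)⌊(n−2)/5⌋; if m ≡ 2 (mod 5), γ_{[k]R}(C_m □ P_n) ≤ ((m+3)/5)(n(k+1) + 2k) − 3k − (k+3)⌊(n−2)/5⌋; if m ≡ 3 (mod 5), γ_{[k]R}(C_m □ P_n) ≤ ((m+2)/5)(n(k+1) + 2k) − 2k − 2⌊(n−2)/5⌋; if m ≡ 4 (mod 5), γ_{[k]R}(C_m □ P_n) ≤ ((m+1)/5)(n(k+1) + 2k) − 2k. -/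

import Mathlib

open Finset
open scoped Classical

/-- The cylindrical grid `C_m □ P_n`: the Cartesian (box) product of the
cycle on `m` vertices with the path on `n` vertices. -/
def cylGrid (m n : ℕ) : SimpleGraph (Fin m × Fin n) :=
  (SimpleGraph.cycleGraph m).boxProd (SimpleGraph.pathGraph n)

/-- `f : V → ℕ` is a `[k]`-Roman dominating function on `G`:
values lie in `{0,…,k+1}`, and every vertex `v` with `f v < k` satisfies
`f(N[v]) ≥ k + |AN(v)|`, where `AN(v)` is the set of neighbors of `v`
with positive label. -/
def IsKRomanDF {V : Type*} [Fintype V] (G : SimpleGraph V) (k : ℕ) (f : V → ℕ) : Prop :=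
  (∀ v, f v ≤ k + 1) ∧
  (∀ v, f v < k →
    k + (Finset.univ.filter fun u => G.Adj v u ∧ 0 < f u).card ≤
      f v + ∑ u ∈ Finset.univ.filter (fun u => G.Adj v u), f u)

/-- The `[k]`-Roman domination number: the minimum total weight of a
`[k]`-Roman dominating function. -/
noncomputable def gammaKR {V : Type*} [Fintype V] (G : SimpleGraph V) (k : ℕ) : ℕ :=
  sInf { w : ℕ | ∃ f : V → ℕ, IsKRomanDF G k f ∧ w = ∑ v, f v }

/-- The packing number: the maximum cardinality of a set of vertices whose
closed neighborhoods are pairwise disjoint. -/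
noncomputable def packingNumber {V : Type*} [Fintype V] (G : SimpleGraph V) : ℕ :=
  sSup { w : ℕ | ∃ D : Set V,
    (D.Pairwise fun u v =>
      Disjoint (insert u (G.neighborSet u)) (insert v (G.neighborSet v))) ∧
    w = D.ncard }

/-- Sufficient local domination condition for the labelling `g` of the cylinder. -/
def LocDom (k m n : ℕ) (g : ℕ → ℕ → ℕ) (i c : ℕ) : Prop :=
  k ≤ g i c ∨ (c + 1 < n ∧ k + 1 ≤ g i c + g i (c + 1)) ∨
    (0 < c ∧ k + 1 ≤ g i c + g i (c - 1)) ∨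
    (i + 1 < m ∧ k + 1 ≤ g i c + g (i + 1) c) ∨
    (i + 1 = m ∧ k + 1 ≤ g i c + g 0 c) ∨
    (0 < i ∧ k + 1 ≤ g i c + g (i - 1) c) ∨
    (i = 0 ∧ k + 1 ≤ g i c + g (m - 1) c)

theorem dom_of_nbr {V : Type*} [Fintype V] (G : SimpleGraph V) (k : ℕ) (f : V → ℕ) (v u : V)
    (hadj : G.Adj v u) (hv : f v < k) (h : k + 1 ≤ f v + f u) :
    k + (Finset.univ.filter fun u => G.Adj v u ∧ 0 < f u).card ≤
      f v + ∑ u ∈ Finset.univ.filter (fun u => G.Adj v u), f u := by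
  have hu : 0 < f u := by omega
  have hmem : u ∈ Finset.univ.filter (fun u => G.Adj v u ∧ 0 < f u) := by simp [hadj, hu]
  have h1 : ∑ w ∈ Finset.univ.filter (fun u => G.Adj v u ∧ 0 < f u), f w ≤
      ∑ w ∈ Finset.univ.filter (fun u => G.Adj v u), f w := by
    apply Finset.sum_le_sum_of_subset
    intro w hw
    simp only [Finset.mem_filter] at hw ⊢
    exact ⟨hw.1, hw.2.1⟩
  rw [← Finset.add_sum_erase _ _ hmem] at h1
  have h2 : ((Finset.univ.filter (fun u => G.Adj v u ∧ 0 < f u)).erase u).card • 1 ≤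
      ∑ w ∈ (Finset.univ.filter (fun u => G.Adj v u ∧ 0 < f u)).erase u, f w := by
    apply Finset.card_nsmul_le_sum
    intro w hw
    simp only [Finset.mem_erase, Finset.mem_filter] at hw
    exact hw.2.2.2
  rw [Finset.card_erase_of_mem hmem] at h2
  simp only [smul_eq_mul, mul_one] at h2
  omega

theorem cyc_adj (m : ℕ) (hm : 3 ≤ m) (a b : Fin m)
    (h : a.val + 1 = b.val ∨ (a.val + 1 = m ∧ b.val = 0)) :
    (SimpleGraph.cycleGraph m).Adj a b := by
  rw [SimpleGraph.cycleGraph_adj']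
  right
  rw [Fin.val_sub]
  rcases h with h | ⟨h, h'⟩
  · rw [← h]
    have : m - a.val + (a.val + 1) = 1 + m := by omega
    rw [this, Nat.add_mod_right, Nat.mod_eq_of_lt (by omega)]
  · rw [h']
    have : m - a.val + 0 = 1 := by omega
    rw [this, Nat.mod_eq_of_lt (by omega)]

theorem gamma_le (k m n : ℕ) (hm : 3 ≤ m) (g : ℕ → ℕ → ℕ)
    (hle : ∀ i c, g i c ≤ k + 1)
    (hdom : ∀ i < m, ∀ c < n, LocDom k m n g i c) :
    gammaKR (cylGrid m n) k ≤ ∑ i ∈ range m, ∑ c ∈ range n, g i c := by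
  apply Nat.sInf_le
  refine ⟨fun v => g v.1.val v.2.val, ⟨fun v => hle _ _, ?_⟩, ?_⟩
  · rintro ⟨⟨i, hi⟩, ⟨c, hc⟩⟩ hv
    simp only at hv
    have key : ∀ (i' c' : ℕ) (hi' : i' < m) (hc' : c' < n),
        (cylGrid m n).Adj (⟨i, hi⟩, ⟨c, hc⟩) (⟨i', hi'⟩, ⟨c', hc'⟩) →
        k + 1 ≤ g i c + g i' c' → _ := fun i' c' hi' hc' hadj hs =>
      dom_of_nbr (cylGrid m n) k (fun v => g v.1.val v.2.val) (⟨i, hi⟩, ⟨c, hc⟩)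
        (⟨i', hi'⟩, ⟨c', hc'⟩) hadj hv hs
    rcases hdom i hi c hc with h | ⟨h1, h⟩ | ⟨h1, h⟩ | ⟨h1, h⟩ | ⟨h1, h⟩ | ⟨h1, h⟩ | ⟨h1, h⟩
    · omega
    · refine key i (c + 1) hi h1 ?_ h
      simp [cylGrid, SimpleGraph.boxProd_adj, SimpleGraph.pathGraph_adj]
    · refine key i (c - 1) hi (by omega) ?_ h
      simp [cylGrid, SimpleGraph.boxProd_adj, SimpleGraph.pathGraph_adj]
      omega
    · refine key (i + 1) c h1 hc ?_ h
      rw [cylGrid, SimpleGraph.boxProd_adj]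
      exact Or.inl ⟨cyc_adj m hm _ _ (Or.inl rfl), rfl⟩
    · refine key 0 c (by omega) hc ?_ h
      rw [cylGrid, SimpleGraph.boxProd_adj]
      exact Or.inl ⟨cyc_adj m hm _ _ (Or.inr ⟨h1, rfl⟩), rfl⟩
    · refine key (i - 1) c (by omega) hc ?_ h
      rw [cylGrid, SimpleGraph.boxProd_adj]
      exact Or.inl ⟨(cyc_adj m hm _ _ (Or.inl (by simp only; omega))).symm, rfl⟩
    · refine key (m - 1) c (by omega) hc ?_ h
      rw [cylGrid, SimpleGraph.boxProd_adj]
      exact Or.inl ⟨(cyc_adj m hm _ _ (Or.inr ⟨by simp only; omega, h1⟩)).symm, rfl⟩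
  · rw [Fintype.sum_prod_type, Finset.sum_range]
    apply Finset.sum_congr rfl
    intro i _
    rw [Finset.sum_range]

/-- The perfect-code pattern with end corrections. -/
def pat (k n q i c : ℕ) : ℕ :=
  if i % 5 = (2 * c + q) % 5 then k + 1
  else if c = 0 ∧ i % 5 = (2 * c + q + 3) % 5 then k
  else if c + 1 = n ∧ i % 5 = (2 * c + q + 2) % 5 then k
  else 0

/-- Perfect-code rows followed by seam rows. -/
def lab (k n q t : ℕ) (S : ℕ → ℕ → ℕ) (i c : ℕ) : ℕ :=
  if i < 5 * t then pat k n q i c else S (i - 5 * t) c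

theorem pat_mod (k n q i c : ℕ) : pat k n q i c = pat k n q (i % 5) c := by
  simp [pat]

theorem pat_col (k n q c : ℕ) :
    ∑ i ∈ range 5, pat k n q i c ≤
      (k + 1) + (if c = 0 then k else 0) + (if c + 1 = n then k else 0) := by
  simp only [Finset.sum_range_succ, Finset.sum_range_zero, pat]
  have : (2 * c + q) % 5 < 5 := Nat.mod_lt _ (by norm_num)
  rw [Nat.add_mod (2 * c + q) 3, Nat.add_mod (2 * c + q) 2]
  generalize (2 * c + q) % 5 = z at *
  interval_cases z <;> by_cases h0 : c = 0 <;> by_cases h1 : c + 1 = n <;>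
    simp [h0, h1] <;> (try split_ifs) <;> omega

theorem end_sum (n a b : ℕ) (hn : 4 ≤ n) :
    ∑ c ∈ range n, ((if c = 0 then a else 0) + (if c + 1 = n then b else 0)) = a + b := by
  rw [Finset.sum_add_distrib]
  congr 1
  · rw [Finset.sum_ite_eq' (range n) 0 (fun _ => a)]
    simp; omega
  · have : ∀ c, (c + 1 = n) = (c = n - 1) := fun c => by apply propext; omega
    simp only [this]
    rw [Finset.sum_ite_eq' (range n) (n - 1) (fun _ => b)]
    simp; omega

theorem pat_sum (k n q t : ℕ) (hn : 4 ≤ n) :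
    ∑ i ∈ range (5 * t), ∑ c ∈ range n, pat k n q i c ≤ t * (n * (k + 1) + 2 * k) := by
  induction t with
  | zero => simp
  | succ t ih =>
    rw [Nat.mul_succ, Finset.sum_range_add]
    have h5 : ∑ x ∈ range 5, ∑ c ∈ range n, pat k n q (5 * t + x) c ≤
        n * (k + 1) + 2 * k := by
      have : ∀ x c, pat k n q (5 * t + x) c = pat k n q x c := by
        intro x c
        rw [pat_mod, Nat.mul_add_mod, ← pat_mod]
      simp only [this]
      rw [Finset.sum_comm]
      calc _ ≤ ∑ c ∈ range n, ((k + 1) + ((if c = 0 then k else 0) +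
            (if c + 1 = n then k else 0))) := by
            apply Finset.sum_le_sum
            intro c _
            have := pat_col k n q c
            omega
        _ = _ := by
            rw [Finset.sum_add_distrib, end_sum n k k hn]
            simp
            ring
    rw [Nat.add_mul, one_mul]
    exact Nat.add_le_add ih h5

theorem lab_sum (k n q t s : ℕ) (S : ℕ → ℕ → ℕ) (hn : 4 ≤ n) :
    ∑ i ∈ range (5 * t + s), ∑ c ∈ range n, lab k n q t S i c ≤
      t * (n * (k + 1) + 2 * k) + ∑ c ∈ range n, ∑ a ∈ range s, S a c := by
  rw [Finset.sum_range_add]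
  apply Nat.add_le_add
  · refine le_trans (le_of_eq ?_) (pat_sum k n q t hn)
    apply Finset.sum_congr rfl
    intro i hi
    rw [Finset.mem_range] at hi
    simp [lab, hi]
  · rw [Finset.sum_comm]
    apply le_of_eq
    simp [lab]

/-- Master lemma: `t ≥ 1` perfect blocks plus a seam of `s` rows. -/
theorem seam (k n q t s : ℕ) (S : ℕ → ℕ → ℕ) (hn : 4 ≤ n) (ht : 1 ≤ t)
    (hS : ∀ a c, S a c ≤ k + 1)
    (hfirst : 0 < s → ∀ c < n, (2 * c + q) % 5 = 0 → S 0 c = k + 1)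
    (hlast : 0 < s → ∀ c < n, (2 * c + q) % 5 = 4 → S (s - 1) c = k + 1)
    (hdom : ∀ a < s, ∀ c < n,
      k ≤ S a c ∨ (c + 1 < n ∧ k + 1 ≤ S a c + S a (c + 1)) ∨
      (0 < c ∧ k + 1 ≤ S a c + S a (c - 1)) ∨
      (a + 1 < s ∧ k + 1 ≤ S a c + S (a + 1) c) ∨
      (a + 1 = s ∧ k + 1 ≤ S a c + pat k n q 0 c) ∨
      (0 < a ∧ k + 1 ≤ S a c + S (a - 1) c) ∨
      (a = 0 ∧ k + 1 ≤ S a c + pat k n q 4 c)) :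
    gammaKR (cylGrid (5 * t + s) n) k ≤
      t * (n * (k + 1) + 2 * k) + ∑ c ∈ range n, ∑ a ∈ range s, S a c := by
  refine le_trans (gamma_le k (5 * t + s) n (by omega) (lab k n q t S) ?_ ?_)
    (lab_sum k n q t s S hn)
  · intro i c
    unfold lab pat
    have := hS (i - 5 * t) c
    split_ifs <;> omega
  have labP : ∀ i c, i < 5 * t → lab k n q t S i c = pat k n q i c := by
    intro i c h; simp [lab, h]
  have labS : ∀ a c, lab k n q t S (5 * t + a) c = S a c := by
    intro a c; simp [lab]
  have patK : ∀ i c, i % 5 = (2 * c + q) % 5 → pat k n q i c = k + 1 := by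
    intro i c h; simp [pat, h]
  intro i hi c hc
  unfold LocDom
  by_cases hit : i < 5 * t
  · have hcases : i % 5 = (2 * c + q) % 5 ∨ i % 5 = (2 * c + q + 1) % 5 ∨
        i % 5 = (2 * c + q + 2) % 5 ∨ i % 5 = (2 * c + q + 3) % 5 ∨
        i % 5 = (2 * c + q + 4) % 5 := by omega
    rcases hcases with h | h | h | h | h
    · left
      rw [labP i c hit, patK i c h]; omega
    · -- the dominating vertex is above
      by_cases h0 : i = 0
      · right; right; right; right; right; right
        refine ⟨h0, ?_⟩
        by_cases hs : s = 0
        · rw [labP (5 * t + s - 1) c (by omega), patK _ c (by omega)]; omega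
        · have e : 5 * t + s - 1 = 5 * t + (s - 1) := by omega
          rw [e, labS, hlast (by omega) c hc (by omega)]; omega
      · right; right; right; right; right; left
        refine ⟨by omega, ?_⟩
        rw [labP (i - 1) c (by omega), patK _ c (by omega)]; omega
    · by_cases hl : c + 1 = n
      · left
        rw [labP i c hit]
        unfold pat
        rw [if_neg (by omega), if_neg (by omega), if_pos ⟨hl, h⟩]
      · right; left
        refine ⟨by omega, ?_⟩
        rw [labP i (c + 1) hit, patK _ _ (by omega)]; omega
    · by_cases hl : c = 0
      · left
        rw [labP i c hit]
        unfold pat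
        rw [if_neg (by omega), if_pos ⟨hl, h⟩]
      · right; right; left
        refine ⟨by omega, ?_⟩
        rw [labP i (c - 1) hit, patK _ _ (by omega)]; omega
    · by_cases h1 : i + 1 < 5 * t
      · right; right; right; left
        refine ⟨by omega, ?_⟩
        rw [labP (i + 1) c h1, patK _ _ (by omega)]; omega
      · have e : i + 1 = 5 * t := by omega
        by_cases hs : s = 0
        · right; right; right; right; left
          refine ⟨by omega, ?_⟩
          rw [labP 0 c (by omega), patK _ _ (by omega)]; omega
        · right; right; right; left
          refine ⟨by omega, ?_⟩
          have e' : i + 1 = 5 * t + 0 := by omega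
          rw [e', labS, hfirst (by omega) c hc (by omega)]; omega
  · obtain ⟨a, rfl⟩ : ∃ a, i = 5 * t + a := ⟨i - 5 * t, by omega⟩
    rw [labS a c, labS a (c + 1), labS a (c - 1)]
    rcases hdom a (by omega) c hc with h | h | h | ⟨h1, h⟩ | ⟨h1, h⟩ | ⟨h1, h⟩ | ⟨h1, h⟩
    · exact Or.inl h
    · exact Or.inr (Or.inl h)
    · exact Or.inr (Or.inr (Or.inl h))
    · right; right; right; left
      refine ⟨by omega, ?_⟩
      rw [add_assoc, labS]; exact h
    · right; right; right; right; left
      refine ⟨by omega, ?_⟩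
      rw [labP 0 c (by omega)]; exact h
    · right; right; right; right; right; left
      refine ⟨by omega, ?_⟩
      have e : 5 * t + a - 1 = 5 * t + (a - 1) := by omega
      rw [e, labS]; exact h
    · right; right; right; right; right; left
      refine ⟨by omega, ?_⟩
      rw [labP _ c (by omega), pat_mod]
      have e : (5 * t + a - 1) % 5 = 4 := by omega
      rw [e]; exact h

theorem pat_zero_one (k n c : ℕ) (h : c % 5 = 2) : pat k n 1 0 c = k + 1 := by
  unfold pat; rw [if_pos (by omega)]

theorem pat_zero_last (k n c : ℕ) (h : c % 5 = 1) (hc : c + 1 = n) : k ≤ pat k n 1 0 c := by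
  unfold pat; rw [if_neg (by omega), if_neg (by omega), if_pos ⟨hc, by omega⟩]

theorem pat_four_one (k n c : ℕ) (h : c % 5 = 4) : pat k n 1 4 c = k + 1 := by
  unfold pat; rw [if_pos (by omega)]

theorem pat_four_first (k n c : ℕ) (h : c = 0) : k ≤ pat k n 1 4 c := by
  unfold pat; rw [if_neg (by omega), if_pos ⟨h, by omega⟩]

theorem pat_zero_three (k n c : ℕ) (h : c % 5 = 1) : pat k n 3 0 c = k + 1 := by
  unfold pat; rw [if_pos (by omega)]

theorem pat_four_three (k n c : ℕ) (h : c % 5 = 3) : pat k n 3 4 c = k + 1 := by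
  unfold pat; rw [if_pos (by omega)]

/-- Seam with one row. -/
def seamA (k n _a c : ℕ) : ℕ :=
  if c % 5 = 2 ∨ c % 5 = 4 then k + 1
  else if c = 0 ∨ (c + 1 = n ∧ c % 5 = 1) then 1 else 0

/-- Seam with two rows. -/
def seamB (k n a c : ℕ) : ℕ :=
  if a = 0 then
    if c % 5 = 2 ∨ (c % 5 = 1 ∧ c ≠ 1) then k + 1
    else if c = 0 then 1
    else if c + 1 = n ∧ c % 5 = 0 then k else 0
  else
    if c % 5 = 4 ∨ c = 1 then k + 1
    else if c + 1 = n ∧ c % 5 = 3 then k else 0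

/-- Seam with three rows. -/
def seamC (k n a c : ℕ) : ℕ :=
  if a = 0 then
    if c % 5 = 2 then k + 1
    else if c = 0 then 1
    else if c % 5 = 0 then (if c + 1 = n then k + 1 else k) else 0
  else if a = 1 then
    if c % 5 = 1 then k + 1
    else if c % 5 = 3 ∧ c + 1 ≠ n then k else 0
  else
    if c % 5 = 4 ∨ (c % 5 = 3 ∧ c + 1 = n) then k + 1
    else if c = 0 then k else 0

/-- Seam with four rows. -/
def seamD (k n a c : ℕ) : ℕ :=
  if a = 0 then
    if c % 5 = 1 ∨ (c % 5 = 4 ∧ c + 1 ≠ n) then k + 1 else 0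
  else if a = 1 then
    if (c % 5 = 2 ∧ c + 1 ≠ n) ∨ (c % 5 = 4 ∧ c + 1 = n) then k + 1 else 0
  else if a = 2 then
    if c % 5 = 0 ∨ (c % 5 = 2 ∧ c + 1 = n) then k + 1 else 0
  else
    if c % 5 = 3 then k + 1 else 0

theorem boundA (k n t : ℕ) (hk : 2 ≤ k) (hn : 4 ≤ n) (ht : 1 ≤ t) :
    gammaKR (cylGrid (5 * t + 1) n) k ≤
      t * (n * (k + 1) + 2 * k) + ∑ c ∈ range n, ∑ a ∈ range 1, seamA k n a c := by
  apply seam k n 1 t 1 _ hn ht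
  · intro a c; unfold seamA; split_ifs <;> omega
  · intro _ c hc h; unfold seamA; rw [if_pos (by omega)]
  · intro _ c hc h; unfold seamA; rw [if_pos (by omega)]
  · intro a ha c hc
    obtain rfl : a = 0 := by omega
    have h1 := pat_zero_one k n c
    have h2 := pat_zero_last k n c
    have h3 := pat_four_one k n c
    have h4 := pat_four_first k n c
    generalize pat k n 1 0 c = p0 at *
    generalize pat k n 1 4 c = p4 at *
    have : c % 5 < 5 := Nat.mod_lt _ (by norm_num)
    unfold seamA
    grind (splits := 40)

theorem boundB (k n t : ℕ) (hk : 2 ≤ k) (hn : 4 ≤ n) (ht : 1 ≤ t) :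
    gammaKR (cylGrid (5 * t + 2) n) k ≤
      t * (n * (k + 1) + 2 * k) + ∑ c ∈ range n, ∑ a ∈ range 2, seamB k n a c := by
  apply seam k n 1 t 2 _ hn ht
  · intro a c; unfold seamB; split_ifs <;> omega
  · intro _ c hc h; unfold seamB; rw [if_pos rfl, if_pos (by omega)]
  · intro _ c hc h; unfold seamB; rw [if_neg (by omega), if_pos (by omega)]
  · intro a ha c hc
    have h1 := pat_zero_one k n c
    have h2 := pat_zero_last k n c
    have h3 := pat_four_one k n c
    have h4 := pat_four_first k n c
    generalize pat k n 1 0 c = p0 at *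
    generalize pat k n 1 4 c = p4 at *
    have : c % 5 < 5 := Nat.mod_lt _ (by norm_num)
    unfold seamB
    interval_cases a <;> simp <;> grind (splits := 40)

theorem boundC (k n t : ℕ) (hk : 2 ≤ k) (hn : 4 ≤ n) (ht : 1 ≤ t) :
    gammaKR (cylGrid (5 * t + 3) n) k ≤
      t * (n * (k + 1) + 2 * k) + ∑ c ∈ range n, ∑ a ∈ range 3, seamC k n a c := by
  apply seam k n 1 t 3 _ hn ht
  · intro a c; unfold seamC; split_ifs <;> omega
  · intro _ c hc h; unfold seamC; rw [if_pos rfl, if_pos (by omega)]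
  · intro _ c hc h; unfold seamC; rw [if_neg (by omega), if_neg (by omega), if_pos (by omega)]
  · intro a ha c hc
    have h1 := pat_zero_one k n c
    have h2 := pat_zero_last k n c
    have h3 := pat_four_one k n c
    have h4 := pat_four_first k n c
    generalize pat k n 1 0 c = p0 at *
    generalize pat k n 1 4 c = p4 at *
    have : c % 5 < 5 := Nat.mod_lt _ (by norm_num)
    unfold seamC
    interval_cases a <;> simp <;> grind (splits := 40)

theorem boundD (k n t : ℕ) (hk : 2 ≤ k) (hn : 4 ≤ n) (ht : 1 ≤ t) :
    gammaKR (cylGrid (5 * t + 4) n) k ≤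
      t * (n * (k + 1) + 2 * k) + ∑ c ∈ range n, ∑ a ∈ range 4, seamD k n a c := by
  apply seam k n 3 t 4 _ hn ht
  · intro a c; unfold seamD; split_ifs <;> omega
  · intro _ c hc h; unfold seamD; rw [if_pos rfl, if_pos (by omega)]
  · intro _ c hc h; unfold seamD
    rw [if_neg (by omega), if_neg (by omega), if_neg (by omega), if_pos (by omega)]
  · intro a ha c hc
    have h1 := pat_zero_three k n c
    have h3 := pat_four_three k n c
    generalize pat k n 3 0 c = p0 at *
    generalize pat k n 3 4 c = p4 at *
    have : c % 5 < 5 := Nat.mod_lt _ (by norm_num)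
    unfold seamD
    interval_cases a <;> simp <;> grind (splits := 40)

/-- A 5-periodic function. -/
def per (a b c d e i : ℕ) : ℕ :=
  if i % 5 = 0 then a else if i % 5 = 1 then b else if i % 5 = 2 then c
  else if i % 5 = 3 then d else e

theorem per_sum (a b c d e F : ℕ) :
    ∑ i ∈ range (5 * F + 2), per a b c d e i = a + b + F * (a + b + c + d + e) := by
  induction F with
  | zero => simp [Finset.sum_range_succ, per]
  | succ F ih =>
    have : 5 * (F + 1) + 2 = 5 * F + 2 + 1 + 1 + 1 + 1 + 1 := by ring
    rw [this]
    simp only [Finset.sum_range_succ _ (5 * F + 2), Finset.sum_range_succ _ (5 * F + 2 + 1),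
      Finset.sum_range_succ _ (5 * F + 2 + 1 + 1),
      Finset.sum_range_succ _ (5 * F + 2 + 1 + 1 + 1),
      Finset.sum_range_succ _ (5 * F + 2 + 1 + 1 + 1 + 1), ih]
    have h2 : per a b c d e (5 * F + 2) = c := by simp [per, Nat.add_mod]
    have h3 : per a b c d e (5 * F + 2 + 1) = d := by simp [per, Nat.add_mod]
    have h4 : per a b c d e (5 * F + 2 + 1 + 1) = e := by simp [per, Nat.add_mod]
    have h5 : per a b c d e (5 * F + 2 + 1 + 1 + 1) = a := by simp [per, Nat.add_mod]
    have h6 : per a b c d e (5 * F + 2 + 1 + 1 + 1 + 1) = b := by simp [per, Nat.add_mod]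
    rw [h2, h3, h4, h5, h6]
    ring

/-- Partial sums of a period starting at residue 2. -/
def part (c d e a r : ℕ) : ℕ :=
  if r = 0 then 0 else if r = 1 then c else if r = 2 then c + d
  else if r = 3 then c + d + e else c + d + e + a

theorem per_sum' (a b c d e F r : ℕ) (hr : r < 5) :
    ∑ i ∈ range (5 * F + 2 + r), per a b c d e i =
      a + b + F * (a + b + c + d + e) + part c d e a r := by
  have h2 : per a b c d e (5 * F + 2) = c := by simp [per, Nat.add_mod]
  have h3 : per a b c d e (5 * F + 2 + 1) = d := by simp [per, Nat.add_mod]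
  have h4 : per a b c d e (5 * F + 2 + 2) = e := by simp [per, Nat.add_mod]
  have h5 : per a b c d e (5 * F + 2 + 3) = a := by simp [per, Nat.add_mod]
  rw [Finset.sum_range_add, per_sum]
  interval_cases r <;> simp [Finset.sum_range_succ, part, h2, h3, h4, h5]

theorem seam_sum (n a b c d e x y F r : ℕ) (w : ℕ → ℕ) (hn : 4 ≤ n) (hr : r < 5)
    (hF : n = 5 * F + 2 + r)
    (hw : ∀ i < n, w i ≤ per a b c d e i +
      ((if i = 0 then x else 0) + (if i + 1 = n then y else 0))) :
    ∑ i ∈ range n, w i ≤ a + b + F * (a + b + c + d + e) + part c d e a r + (x + y) := by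
  calc _ ≤ ∑ i ∈ range n, (per a b c d e i +
      ((if i = 0 then x else 0) + (if i + 1 = n then y else 0))) :=
        Finset.sum_le_sum fun i hi => hw i (Finset.mem_range.1 hi)
    _ = _ := by
      rw [Finset.sum_add_distrib, end_sum n x y hn]
      congr 1
      rw [hF, per_sum' _ _ _ _ _ _ _ hr]

theorem sumA (k n F r : ℕ) (hk : 2 ≤ k) (hn : 4 ≤ n) (hr : r < 5) (hF : n = 5 * F + 2 + r) :
    (∑ c ∈ range n, ∑ a ∈ range 1, seamA k n a c) + (2 * k + 1) + 2 * (k + 2) * F ≤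
      n * (k + 1) := by
  have h := seam_sum n 0 0 (k + 1) 0 (k + 1) 1 (if r = 0 then 1 else 0) F r
    (fun c => ∑ a ∈ range 1, seamA k n a c) hn hr hF (by
      intro c hc
      simp only [Finset.sum_range_succ, Finset.sum_range_zero, seamA, per]
      have : c % 5 < 5 := Nat.mod_lt _ (by norm_num)
      grind (splits := 40))
  have hF1 : r = 0 → F ≤ F * (k - 1) ∧ 1 ≤ F := by
    intro h0
    exact ⟨Nat.le_mul_of_pos_right _ (by omega), by omega⟩
  obtain ⟨l, rfl⟩ : ∃ l, k = l + 2 := ⟨k - 2, by omega⟩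
  refine le_trans (Nat.add_le_add_right (Nat.add_le_add_right h _) _) ?_
  subst hF
  interval_cases r <;> simp [part] <;> nlinarith [Nat.zero_le (F * l)]

theorem sumB (k n F r : ℕ) (hk : 2 ≤ k) (hn : 4 ≤ n) (hr : r < 5) (hF : n = 5 * F + 2 + r) :
    (∑ c ∈ range n, ∑ a ∈ range 2, seamB k n a c) + k + (k + 3) * F ≤
      n * (k + 1) := by
  have h := seam_sum n 0 (k + 1) (k + 1) 0 (k + 1) 1 (if r = 2 ∨ r = 4 then k else 0) F r
    (fun c => ∑ a ∈ range 2, seamB k n a c) hn hr hF (by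
      intro c hc
      simp only [Finset.sum_range_succ, Finset.sum_range_zero, seamB, per]
      have : c % 5 < 5 := Nat.mod_lt _ (by norm_num)
      grind (splits := 40))
  obtain ⟨l, rfl⟩ : ∃ l, k = l + 2 := ⟨k - 2, by omega⟩
  refine le_trans (Nat.add_le_add_right (Nat.add_le_add_right h _) _) ?_
  subst hF
  interval_cases r <;> simp [part] <;> nlinarith [Nat.zero_le (F * l)]

theorem sumC (k n F r : ℕ) (hk : 2 ≤ k) (hn : 4 ≤ n) (hr : r < 5) (hF : n = 5 * F + 2 + r) :
    (∑ c ∈ range n, ∑ a ∈ range 3, seamC k n a c) + 2 * F ≤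
      n * (k + 1) := by
  have h := seam_sum n k (k + 1) (k + 1) k (k + 1) 1 (if r = 2 ∨ r = 4 then 1 else 0) F r
    (fun c => ∑ a ∈ range 3, seamC k n a c) hn hr hF (by
      intro c hc
      simp only [Finset.sum_range_succ, Finset.sum_range_zero, seamC, per]
      have : c % 5 < 5 := Nat.mod_lt _ (by norm_num)
      grind (splits := 40))
  refine le_trans (Nat.add_le_add_right h _) ?_
  subst hF
  interval_cases r <;> simp [part] <;> nlinarith [Nat.zero_le (F * k)]

theorem sumD (k n : ℕ) :
    (∑ c ∈ range n, ∑ a ∈ range 4, seamD k n a c) ≤ n * (k + 1) := by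
  calc _ ≤ ∑ c ∈ range n, (k + 1) := by
        apply Finset.sum_le_sum
        intro c hc
        simp only [Finset.sum_range_succ, Finset.sum_range_zero, seamD]
        have : c % 5 < 5 := Nat.mod_lt _ (by norm_num)
        grind (splits := 40)
    _ = _ := by simp

theorem bound_four (k n : ℕ) (hn : 4 ≤ n) : gammaKR (cylGrid 4 n) k ≤ n * (k + 1) := by
  refine le_trans (gamma_le k 4 n (by norm_num)
    (fun i c => if i = 2 * (c % 2) then k + 1 else 0) ?_ ?_) ?_
  · intro i c; split_ifs <;> omega
  · intro i hi c hc
    unfold LocDom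
    have : c % 2 < 2 := Nat.mod_lt _ (by norm_num)
    interval_cases i <;> simp <;> grind (splits := 40)
  · rw [Finset.sum_comm]
    calc _ ≤ ∑ c ∈ range n, (k + 1) := by
          apply Finset.sum_le_sum
          intro c hc
          simp only [Finset.sum_range_succ, Finset.sum_range_zero]
          split_ifs <;> omega
      _ = _ := by simp

/-- Labelling of the cylinder with three rows. -/
def labE (k n i c : ℕ) : ℕ :=
  if c % 2 = 1 then
    if i = 0 then (if c + 1 = n then k + 1 else k) else 0
  else if c % 4 = 0 then
    if i = 1 then k + 1 else 0
  else
    if i = 2 then k + 1 else 0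

theorem bound_three (k n F r : ℕ) (hk : 2 ≤ k) (hn : 4 ≤ n) (hF : n = 5 * F + 2 + r) :
    gammaKR (cylGrid 3 n) k + 2 * F ≤ n * (k + 1) := by
  have h := gamma_le k 3 n (by norm_num) (labE k n) (by
      intro i c; unfold labE; split_ifs <;> omega) (by
      intro i hi c hc
      unfold LocDom labE
      have : c % 4 < 4 := Nat.mod_lt _ (by norm_num)
      interval_cases i <;> simp <;> grind (splits := 40))
  rw [Finset.sum_comm] at h
  have hs : ∀ N, N < n → (∑ c ∈ range N, ∑ i ∈ range 3, labE k n i c) + N / 2 ≤ N * (k + 1) := by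
    intro N
    induction N with
    | zero => simp
    | succ N ih =>
      intro hN
      have ih' := ih (by omega)
      rw [Finset.sum_range_succ, Nat.add_mul, one_mul]
      have : (∑ i ∈ range 3, labE k n i N) + (N + 1) / 2 ≤ k + 1 + N / 2 := by
        simp only [Finset.sum_range_succ, Finset.sum_range_zero, labE]
        grind (splits := 40)
      omega
  have h1 := hs (n - 1) (by omega)
  obtain ⟨N, rfl⟩ : ∃ N, n = N + 1 := ⟨n - 1, by omega⟩
  rw [Finset.sum_range_succ] at h
  have : (∑ i ∈ range 3, labE k (N + 1) i N) ≤ k + 1 := by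
    simp only [Finset.sum_range_succ, Finset.sum_range_zero, labE]
    grind (splits := 40)
  rw [Nat.add_mul, one_mul]
  simp only [Nat.add_sub_cancel] at h1
  omega

theorem gammaKR_mod5 (k m n : ℕ) (hk : 2 ≤ k) (hm : 3 ≤ m) (hn : 4 ≤ n) :
    (m % 5 = 0 →
      (gammaKR (cylGrid m n) k : ℤ) ≤
        ((m : ℤ) / 5) * ((n : ℤ) * ((k : ℤ) + 1) + 2 * (k : ℤ))) ∧
    (m % 5 = 1 →
      (gammaKR (cylGrid m n) k : ℤ) ≤
        (((m : ℤ) + 4) / 5) * ((n : ℤ) * ((k : ℤ) + 1) + 2 * (k : ℤ)) -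
          (4 * (k : ℤ) + 1) - 2 * ((k : ℤ) + 2) * ⌊((n : ℚ) - 2) / 5⌋) ∧
    (m % 5 = 2 →
      (gammaKR (cylGrid m n) k : ℤ) ≤
        (((m : ℤ) + 3) / 5) * ((n : ℤ) * ((k : ℤ) + 1) + 2 * (k : ℤ)) -
          3 * (k : ℤ) - ((k : ℤ) + 3) * ⌊((n : ℚ) - 2) / 5⌋) ∧
    (m % 5 = 3 →
      (gammaKR (cylGrid m n) k : ℤ) ≤
        (((m : ℤ) + 2) / 5) * ((n : ℤ) * ((k : ℤ) + 1) + 2 * (k : ℤ)) -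
          2 * (k : ℤ) - 2 * ⌊((n : ℚ) - 2) / 5⌋) ∧
    (m % 5 = 4 →
      (gammaKR (cylGrid m n) k : ℤ) ≤
        (((m : ℤ) + 1) / 5) * ((n : ℤ) * ((k : ℤ) + 1) + 2 * (k : ℤ)) -
          2 * (k : ℤ)) := by
  obtain ⟨F, r, hr, hF⟩ : ∃ F r, r < 5 ∧ n = 5 * F + 2 + r :=
    ⟨(n - 2) / 5, (n - 2) % 5, by omega, by omega⟩
  have hfl : ⌊((n : ℚ) - 2) / 5⌋ = (F : ℤ) := by
    rw [Int.floor_eq_iff, hF]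
    have h1 : (r : ℚ) < 5 := by exact_mod_cast hr
    have h2 : (0 : ℚ) ≤ r := by positivity
    push_cast
    constructor <;> linarith
  rw [hfl]
  obtain ⟨t, ht⟩ : ∃ t, t = m / 5 := ⟨_, rfl⟩
  refine ⟨fun h => ?_, fun h => ?_, fun h => ?_, fun h => ?_, fun h => ?_⟩
  · obtain rfl : m = 5 * t + 0 := by omega
    have h1 := seam k n 1 t 0 (fun _ _ => 0) hn (by omega) (by simp) (by simp) (by simp) (by simp)
    have e : ((5 * t + 0 : ℕ) : ℤ) / 5 = t := by omega
    rw [e]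
    simp only [Finset.sum_range_zero, Finset.sum_const_zero, add_zero] at h1 ⊢
    exact_mod_cast h1
  · obtain rfl : m = 5 * t + 1 := by omega
    have h1 := boundA k n t hk hn (by omega)
    have h2 := sumA k n F r hk hn hr hF
    have e : (((5 * t + 1 : ℕ) : ℤ) + 4) / 5 = t + 1 := by omega
    rw [e]
    zify at h1 h2
    linarith
  · obtain rfl : m = 5 * t + 2 := by omega
    have h1 := boundB k n t hk hn (by omega)
    have h2 := sumB k n F r hk hn hr hF
    have e : (((5 * t + 2 : ℕ) : ℤ) + 3) / 5 = t + 1 := by omega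
    rw [e]
    zify at h1 h2
    linarith
  · obtain rfl : m = 5 * t + 3 := by omega
    have e : (((5 * t + 3 : ℕ) : ℤ) + 2) / 5 = t + 1 := by omega
    rw [e]
    rcases Nat.eq_zero_or_pos t with h0 | h0
    · subst h0
      have h1 := bound_three k n F r hk hn hF
      zify at h1
      simp only [mul_zero, zero_add, Nat.cast_zero]
      linarith
    · have h1 := boundC k n t hk hn h0
      have h2 := sumC k n F r hk hn hr hF
      zify at h1 h2
      linarith
  · obtain rfl : m = 5 * t + 4 := by omega
    have e : (((5 * t + 4 : ℕ) : ℤ) + 1) / 5 = t + 1 := by omega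
    rw [e]
    rcases Nat.eq_zero_or_pos t with h0 | h0
    · subst h0
      have h1 := bound_four k n hn
      zify at h1
      simp only [mul_zero, zero_add, Nat.cast_zero]
      linarith
    · have h1 := boundD k n t hk hn h0
      have h2 := sumD k n
      zify at h1 h2
      linarith
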